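/- Let τ be a 2^L × 2^L matrix expanded in the Pauli-string basis as τ = ∑_P c̄_P P with real coefficients c̄_P. Then Tr(τ · S[τ]) = 2^L · ( ∑_{P : last factor = I₂} c̄_P² − (1/3) ∑_{P : last factor ≠ I₂} c̄_P² ) = Tr(τ²) − (4/3)·2^L·w_L(τ). In particular, if Tr(τ²) = 2^L (equivalently ∑_P c̄_P² = 1) then Tr(τ · S[τ]) = 2^L·(1 − (4/3)·w_L(τ)). -/

import Mathlib

open Matrix

/-- The 2×2 Pauli matrix X. -/
noncomputable def pauliX : Matrix (Fin 2) (Fin 2) ℂ := !![0, 1; 1, 0]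

/-- The 2×2 Pauli matrix Y. -/
noncomputable def pauliY : Matrix (Fin 2) (Fin 2) ℂ := !![0, -Complex.I; Complex.I, 0]

/-- The four single-site Pauli matrices `σ₀ = I₂`, `σ₁ = X`, `σ₂ = Y`, `σ₃ = Z`. -/
noncomputable def pauli4 : Fin 4 → Matrix (Fin 2) (Fin 2) ℂ :=
  ![1, pauliX, pauliY, !![1, 0; 0, -1]]

/-- The Pauli string `P = σ_{μ₁} ⊗ ⋯ ⊗ σ_{μ_L}` on `L` qubits, realized as a matrix on
the Hilbert space `ℂ^{2^L}` indexed by spin configurations `Fin L → Fin 2`. -/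
noncomputable def pauliString (L : ℕ) (μ : Fin L → Fin 4) :
    Matrix (Fin L → Fin 2) (Fin L → Fin 2) ℂ :=
  Matrix.of fun i j => ∏ s, pauli4 (μ s) (i s) (j s)

/-- The jump operator at site `s0` (the site next to the bath): the Pauli string that is
`σ_j` at `s0` and the identity elsewhere, for `j = 1, 2, 3`. -/
noncomputable def jumpOpAt (L : ℕ) (s0 : Fin L) (j : Fin 3) :
    Matrix (Fin L → Fin 2) (Fin L → Fin 2) ℂ :=
  pauliString L (fun s => if s = s0 then j.succ else 0)

/-- The bath superoperator `S[ρ] = (1/3) ∑_{j=1}^3 E_j ρ E_j†`, with jump operators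
acting at site `s0`. -/
noncomputable def bathSAt (L : ℕ) (s0 : Fin L)
    (ρ : Matrix (Fin L → Fin 2) (Fin L → Fin 2) ℂ) :
    Matrix (Fin L → Fin 2) (Fin L → Fin 2) ℂ :=
  (1/3 : ℂ) • ∑ j : Fin 3, jumpOpAt L s0 j * ρ * (jumpOpAt L s0 j)ᴴ

theorem of_prod_mul_of_prod {ι n R : Type*} [Fintype ι] [DecidableEq ι] [Fintype n]
    [CommSemiring R] (A B : ι → Matrix n n R) :
    (Matrix.of fun i j : ι → n => ∏ s, A s (i s) (j s)) *
        (Matrix.of fun i j : ι → n => ∏ s, B s (i s) (j s)) =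
      Matrix.of fun i j : ι → n => ∏ s, (A s * B s) (i s) (j s) := by
  ext i j
  simp only [Matrix.mul_apply, Matrix.of_apply, Finset.prod_univ_sum, Fintype.piFinset_univ,
    Finset.prod_mul_distrib]

theorem trace_of_prod {ι n R : Type*} [Fintype ι] [DecidableEq ι] [Fintype n]
    [CommSemiring R] (A : ι → Matrix n n R) :
    (Matrix.of fun i j : ι → n => ∏ s, A s (i s) (j s)).trace = ∏ s, (A s).trace := by
  simp only [Matrix.trace, Matrix.diag_apply, Matrix.of_apply, Finset.prod_univ_sum,
    Fintype.piFinset_univ]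

/-- The sign relating `σ_a σ_b` and `σ_b σ_a`. -/
noncomputable def pauliSign (a b : Fin 4) : ℂ := if a = 0 ∨ b = 0 ∨ a = b then 1 else -1

theorem pauli4_conj (a b : Fin 4) :
    pauli4 a * pauli4 b * (pauli4 a)ᴴ = pauliSign a b • pauli4 b := by
  fin_cases a <;> fin_cases b <;> ext i j <;> fin_cases i <;> fin_cases j <;>
    simp [pauli4, pauliX, pauliY, pauliSign, Matrix.mul_apply]

theorem trace_pauli4_mul (a b : Fin 4) :
    (pauli4 a * pauli4 b).trace = if a = b then 2 else 0 := by
  fin_cases a <;> fin_cases b <;>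
    simp [pauli4, pauliX, pauliY, Matrix.trace] <;> norm_num

theorem trace_pauliString_mul (L : ℕ) (μ ν : Fin L → Fin 4) :
    (pauliString L μ * pauliString L ν).trace = if μ = ν then (2 : ℂ) ^ L else 0 := by
  rw [pauliString, pauliString, of_prod_mul_of_prod, trace_of_prod]
  simp only [trace_pauli4_mul]
  split_ifs with h
  · simp [h]
  · obtain ⟨s, hs⟩ := Function.ne_iff.mp h
    exact Finset.prod_eq_zero (Finset.mem_univ s) (if_neg hs)

theorem conjTranspose_pauliString (L : ℕ) (μ : Fin L → Fin 4) :
    (pauliString L μ)ᴴ = Matrix.of fun i j => ∏ s, (pauli4 (μ s))ᴴ (i s) (j s) := by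
  ext i j
  simp [pauliString, Matrix.conjTranspose_apply]

theorem pauliString_conj (L : ℕ) (μ ν : Fin L → Fin 4) :
    pauliString L μ * pauliString L ν * (pauliString L μ)ᴴ =
      (∏ s, pauliSign (μ s) (ν s)) • pauliString L ν := by
  rw [conjTranspose_pauliString, pauliString, pauliString, of_prod_mul_of_prod,
    of_prod_mul_of_prod]
  ext i j
  simp [pauli4_conj, Finset.prod_mul_distrib]

theorem jumpOpAt_conj_pauliString (L : ℕ) (s0 : Fin L) (j : Fin 3) (μ : Fin L → Fin 4) :
    jumpOpAt L s0 j * pauliString L μ * (jumpOpAt L s0 j)ᴴ =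
      pauliSign j.succ (μ s0) • pauliString L μ := by
  rw [jumpOpAt, pauliString_conj]
  congr 1
  rw [Finset.prod_eq_single s0]
  · simp
  · intro s _ hs
    simp [hs, pauliSign]
  · simp

theorem sum_pauliSign (b : Fin 4) :
    ∑ j : Fin 3, pauliSign j.succ b = if b = 0 then 3 else -1 := by
  simp only [Fin.sum_univ_three, pauliSign]
  fin_cases b <;> norm_num [Fin.ext_iff]

theorem bathSAt_pauliString (L : ℕ) (s0 : Fin L) (μ : Fin L → Fin 4) :
    bathSAt L s0 (pauliString L μ) =
      (if μ s0 = 0 then (1 : ℂ) else -(1 / 3)) • pauliString L μ := by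
  simp only [bathSAt, jumpOpAt_conj_pauliString]
  rw [← Finset.sum_smul, sum_pauliSign, smul_smul]
  congr 1
  split_ifs <;> norm_num

theorem bathSAt_sum_smul {ι : Type*} (t : Finset ι) (L : ℕ) (s0 : Fin L) (c : ι → ℂ)
    (ρ : ι → Matrix (Fin L → Fin 2) (Fin L → Fin 2) ℂ) :
    bathSAt L s0 (∑ k ∈ t, c k • ρ k) = ∑ k ∈ t, c k • bathSAt L s0 (ρ k) := by
  simp only [bathSAt, Finset.mul_sum, Finset.sum_mul, Matrix.mul_smul, Matrix.smul_mul]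
  rw [Finset.sum_comm, Finset.smul_sum]
  refine Finset.sum_congr rfl fun k _ => ?_
  rw [← Finset.smul_sum, smul_comm]

theorem trace_sum_pauliString_mul (L : ℕ) (c d : (Fin L → Fin 4) → ℂ) :
    ((∑ μ, c μ • pauliString L μ) * ∑ μ, d μ • pauliString L μ).trace =
      2 ^ L * ∑ μ, c μ * d μ := by
  rw [Finset.sum_mul_sum, Finset.mul_sum]
  simp only [Matrix.trace_sum, Matrix.smul_mul, Matrix.mul_smul, Matrix.trace_smul,
    trace_pauliString_mul, smul_eq_mul, mul_ite, mul_zero, Finset.sum_ite_eq, Finset.mem_univ,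
    if_true]
  exact Finset.sum_congr rfl fun μ _ => by ring

/-- Let `τ = ∑_P c̄_P P` be expanded in the Pauli-string basis with real coefficients.
Then `Tr(τ·S[τ]) = 2^L (∑_{P : last = I} c̄_P² − (1/3) ∑_{P : last ≠ I} c̄_P²)
= Tr(τ²) − (4/3)·2^L·w_L(τ)`; and if `Tr(τ²) = 2^L` then
`Tr(τ·S[τ]) = 2^L (1 − (4/3) w_L(τ))`, where `w_L(τ) = ∑_{P : last ≠ I} c̄_P²`. -/
theorem trace_tau_bathS_tau_pauli (L : ℕ) (hL : 1 ≤ L)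
    (lastSite : Fin L) (hlast : (lastSite : ℕ) = L - 1)
    (cb : (Fin L → Fin 4) → ℝ)
    (τ : Matrix (Fin L → Fin 2) (Fin L → Fin 2) ℂ)
    (hτ : τ = ∑ μ, (cb μ : ℂ) • pauliString L μ)
    (w : ℝ)
    (hw : w = ∑ μ ∈ Finset.univ.filter (fun μ : Fin L → Fin 4 => μ lastSite ≠ 0), (cb μ) ^ 2) :
    (τ * bathSAt L lastSite τ).trace
        = (2 ^ L : ℂ) *
          (((∑ μ ∈ Finset.univ.filter (fun μ : Fin L → Fin 4 => μ lastSite = 0), (cb μ) ^ 2)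
            - (1/3) * ∑ μ ∈ Finset.univ.filter (fun μ : Fin L → Fin 4 => μ lastSite ≠ 0),
                (cb μ) ^ 2 : ℝ) : ℂ) ∧
    (τ * bathSAt L lastSite τ).trace
        = (τ * τ).trace - (((4/3) * 2 ^ L * w : ℝ) : ℂ) ∧
    ((τ * τ).trace = (2 ^ L : ℂ) →
      (τ * bathSAt L lastSite τ).trace = ((2 ^ L * (1 - (4/3) * w) : ℝ) : ℂ)) := by
  have hS : (τ * bathSAt L lastSite τ).trace = (2 ^ L : ℂ) *
      (((∑ μ ∈ Finset.univ.filter (fun μ : Fin L → Fin 4 => μ lastSite = 0), (cb μ) ^ 2)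
        - (1/3) * ∑ μ ∈ Finset.univ.filter (fun μ : Fin L → Fin 4 => μ lastSite ≠ 0),
            (cb μ) ^ 2 : ℝ) : ℂ) := by
    rw [hτ, bathSAt_sum_smul]
    simp only [bathSAt_pauliString, smul_smul]
    rw [trace_sum_pauliString_mul]
    push_cast
    rw [Finset.sum_filter, Finset.sum_filter,
      Finset.mul_sum _ _ (1 / 3 : ℂ), ← Finset.sum_sub_distrib]
    congr 1
    refine Finset.sum_congr rfl fun μ _ => ?_
    by_cases h : μ lastSite = 0 <;> simp [h] <;> ring
  have hsq : (τ * τ).trace = (2 ^ L : ℂ) *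
      (((∑ μ ∈ Finset.univ.filter (fun μ : Fin L → Fin 4 => μ lastSite = 0), (cb μ) ^ 2)
        + w : ℝ) : ℂ) := by
    rw [hw, Finset.sum_filter_add_sum_filter_not, hτ, trace_sum_pauliString_mul]
    simp [sq]
  have hdiff : (τ * bathSAt L lastSite τ).trace
      = (τ * τ).trace - (((4/3) * 2 ^ L * w : ℝ) : ℂ) := by
    rw [hS, hsq, ← hw]
    push_cast
    ring
  refine ⟨hS, hdiff, fun h => ?_⟩
  rw [hdiff, h]
  push_cast
  ring
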